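/- arXiv:2201.10245 — 6 statements merged into one kernel-verified Lean document; each statement's English description precedes it below -/
import Mathlib

section
/- Let f : ℝ^d → ℝ be L-smooth with global minimizer x*, and suppose there exist θ₁' > 0, θ₂' ≥ 0 and R ≥ 0 such that ⟨x, ∇f(x)⟩ ≥ θ₁'‖x‖² − θ₂' for all x with ‖x − x*‖ ≥ R. Then for all x with ‖x − x*‖ ≥ R, ⟨x − x*, ∇f(x)⟩ ≥ (θ₁'/2)‖x − x*‖² − ((θ₁' + 2L + L²/(2θ₁'))‖x*‖² + θ₂'); i.e., f is R-dissipative with θ₁ = θ₁'/2 and θ₂ = (θ₁' + 2L + L²/(2θ₁'))‖x*‖² + θ₂'. -/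
open scoped InnerProductSpace

/-- Remark 3.1.
If `f` is `L`-smooth with global minimizer `x*` and satisfies
`⟪x, ∇f x⟫ ≥ θ₁' ‖x‖² - θ₂'` for all `x` with `‖x - x*‖ ≥ R`, then `f` is
`R`-dissipative with `θ₁ = θ₁'/2` and
`θ₂ = (θ₁' + 2L + L²/(2θ₁')) ‖x*‖² + θ₂'`. -/
theorem dissipativity_from_origin_form
    {d : ℕ} (f : EuclideanSpace ℝ (Fin d) → ℝ)
    (f' : EuclideanSpace ℝ (Fin d) → EuclideanSpace ℝ (Fin d))
    (hf : ∀ y, HasGradientAt f (f' y) y)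
    (L : ℝ) (hL : 0 < L)
    (hsmooth : ∀ y z, ‖f' y - f' z‖ ≤ L * ‖y - z‖)
    (xstar : EuclideanSpace ℝ (Fin d)) (hmin : ∀ y, f xstar ≤ f y)
    (θ₁' θ₂' R : ℝ) (hθ₁' : 0 < θ₁') (hθ₂' : 0 ≤ θ₂') (hR : 0 ≤ R)
    (hdiss' : ∀ x, R ≤ ‖x - xstar‖ → θ₁' * ‖x‖ ^ 2 - θ₂' ≤ ⟪x, f' x⟫_ℝ) :
    ∀ x, R ≤ ‖x - xstar‖ →
      (θ₁' / 2) * ‖x - xstar‖ ^ 2 -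
          ((θ₁' + 2 * L + L ^ 2 / (2 * θ₁')) * ‖xstar‖ ^ 2 + θ₂') ≤
        ⟪x - xstar, f' x⟫_ℝ := by
  intro x hx
  have hcrit : f' xstar = 0 := by
    have h := IsLocalMin.hasFDerivAt_eq_zero (Filter.Eventually.of_forall hmin)
      (hf xstar).hasFDerivAt
    simpa using h
  have hgrad : ‖f' x‖ ≤ L * ‖x - xstar‖ := by
    simpa [hcrit] using hsmooth x xstar
  have hcross : ⟪xstar, f' x⟫_ℝ ≤ ‖xstar‖ * (L * ‖x - xstar‖) :=
    (real_inner_le_norm _ _).trans (by gcongr)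
  have hnorm : (‖x - xstar‖ - ‖xstar‖) ^ 2 ≤ ‖x‖ ^ 2 := by
    rw [sq_le_sq, abs_norm]
    simpa using abs_norm_sub_norm_le (x - xstar) (-xstar)
  have hmul := mul_le_mul_of_nonneg_left hnorm hθ₁'.le
  have hdiss := hdiss' x hx
  have hsquare : 0 ≤ (θ₁' * ‖x - xstar‖ - (2 * θ₁' + L) * ‖xstar‖) ^ 2 / (2 * θ₁') := by
    positivity
  have hexpand : (θ₁' * ‖x - xstar‖ - (2 * θ₁' + L) * ‖xstar‖) ^ 2 / (2 * θ₁') =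
      θ₁' * (‖x - xstar‖ - ‖xstar‖) ^ 2 - ‖xstar‖ * (L * ‖x - xstar‖) -
        θ₁' / 2 * ‖x - xstar‖ ^ 2 + (θ₁' + 2 * L + L ^ 2 / (2 * θ₁')) * ‖xstar‖ ^ 2 := by
    field_simp
    ring
  rw [inner_sub_left]
  linarith
end

section
/- Let f : ℝ^d → ℝ be differentiable with global minimizer x* ≠ 0, let p ∈ (0,2), 0 < τ < p/2, θ₁' > 0, θ₂' ≥ 0, θ₃ > 0, and let R ≥ max{2‖x*‖, 1}. Suppose that for all x with ‖x − x*‖ ≥ R one has ⟨∇f(x), x⟩ ≥ θ₁'‖x‖^p − θ₂' and ‖∇f(x)‖² ≤ θ₃(1 + ‖x − x*‖^{2τ}). Then for all x with ‖x − x*‖ ≥ R, ⟨∇f(x), x − x*⟩ ≥ θ₁‖x − x*‖^p − θ₂, where θ₁ = θ₁'/2^{p+1} and θ₂ = θ₂' + ‖x*‖^{α₂}/(s^{α₂}α₂) with α₂ = p/(p−τ) and s = (θ₁'p/(τ·2^{p+1}))^{τ/p}/√(2θ₃). -/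
open MeasureTheory
open scoped InnerProductSpace

/-- Remark 4.1, checking generalized `R`-dissipativity.
If `⟪∇f x, x⟫ ≥ θ₁' ‖x‖^p - θ₂'` and `‖∇f x‖² ≤ θ₃ (1 + ‖x - x*‖^{2τ})` for all
`x` with `‖x - x*‖ ≥ R ≥ max {2‖x*‖, 1}`, then
`⟪∇f x, x - x*⟫ ≥ θ₁ ‖x - x*‖^p - θ₂` with `θ₁ = θ₁'/2^{p+1}` and
`θ₂ = θ₂' + ‖x*‖^{α₂}/(s^{α₂} α₂)`, `α₂ = p/(p-τ)`,
`s = (θ₁' p/(τ 2^{p+1}))^{τ/p}/√(2θ₃)`. -/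
theorem generalized_dissipativity_from_origin_form
    {d : ℕ} (f : EuclideanSpace ℝ (Fin d) → ℝ)
    (f' : EuclideanSpace ℝ (Fin d) → EuclideanSpace ℝ (Fin d))
    (hf : ∀ y, HasGradientAt f (f' y) y)
    (xstar : EuclideanSpace ℝ (Fin d)) (hmin : ∀ y, f xstar ≤ f y)
    (hxstar : xstar ≠ 0)
    (p τ : ℝ) (hp : p ∈ Set.Ioo (0 : ℝ) 2) (hτ0 : 0 < τ) (hτ : τ < p / 2)
    (θ₁' θ₂' θ₃ R : ℝ) (hθ₁' : 0 < θ₁') (hθ₂' : 0 ≤ θ₂') (hθ₃ : 0 < θ₃)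
    (hR : max (2 * ‖xstar‖) 1 ≤ R)
    (hdiss' : ∀ x, R ≤ ‖x - xstar‖ → θ₁' * ‖x‖ ^ p - θ₂' ≤ ⟪f' x, x⟫_ℝ)
    (hgrowth : ∀ x, R ≤ ‖x - xstar‖ →
      ‖f' x‖ ^ 2 ≤ θ₃ * (1 + ‖x - xstar‖ ^ (2 * τ)))
    (α₂ s : ℝ) (hα₂ : α₂ = p / (p - τ))
    (hs : s = (θ₁' * p / (τ * (2 : ℝ) ^ (p + 1))) ^ (τ / p) / Real.sqrt (2 * θ₃)) :
    ∀ x, R ≤ ‖x - xstar‖ →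
      (θ₁' / (2 : ℝ) ^ (p + 1)) * ‖x - xstar‖ ^ p -
          (θ₂' + ‖xstar‖ ^ α₂ / (s ^ α₂ * α₂)) ≤
        ⟪f' x, x - xstar⟫_ℝ := by
  intro x hx
  obtain ⟨hp0, -⟩ := hp
  set r := ‖x - xstar‖ with hr_def
  have hr1 : 1 ≤ r := (le_max_right _ _).trans (hR.trans hx)
  have hr2 : 2 * ‖xstar‖ ≤ r := (le_max_left _ _).trans (hR.trans hx)
  have hr0 : 0 < r := by linarith
  have hnorm : r / 2 ≤ ‖x‖ := by
    have := norm_sub_le x xstar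
    linarith
  have hτp : τ < p := by linarith
  have hpow : r ^ p / 2 ^ p ≤ ‖x‖ ^ p := by
    rw [← Real.div_rpow hr0.le zero_le_two]
    exact Real.rpow_le_rpow (by positivity) hnorm hp0.le
  have hgrad : ‖f' x‖ ≤ √(2 * θ₃) * r ^ τ := by
    refine (sq_le_sq₀ (norm_nonneg _) (by positivity)).1 ?_
    have h1 : 1 ≤ r ^ (2 * τ) := Real.one_le_rpow hr1 (by positivity)
    have h2 : (r ^ τ) ^ 2 = r ^ (2 * τ) := by
      rw [← Real.rpow_natCast, ← Real.rpow_mul hr0.le, mul_comm τ]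
      norm_num
    rw [mul_pow, Real.sq_sqrt (by positivity), h2]
    nlinarith [hgrowth x hx]
  have hcross : ⟪f' x, xstar⟫_ℝ ≤ √(2 * θ₃) * r ^ τ * ‖xstar‖ :=
    (real_inner_le_norm _ _).trans (by gcongr)
  have hconj : (p / τ).HolderConjugate α₂ := by
    rw [Real.holderConjugate_iff, hα₂]
    have : p - τ ≠ 0 := by linarith
    refine ⟨(one_lt_div hτ0).2 hτp, ?_⟩
    field_simp
    ring
  have h2p : (2 : ℝ) ^ (p + 1) = 2 * 2 ^ p := by
    rw [Real.rpow_add_one two_ne_zero, mul_comm]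
  set c := θ₁' * p / (τ * (2 : ℝ) ^ (p + 1)) with hc
  have hc0 : 0 < c := by positivity
  have hs0 : 0 < s := by rw [hs]; positivity
  have hyoung := Real.young_inequality_of_nonneg
    (show 0 ≤ c ^ (τ / p) * r ^ τ by positivity)
    (show 0 ≤ ‖xstar‖ / s by positivity) hconj
  have hprod : c ^ (τ / p) * r ^ τ * (‖xstar‖ / s) = √(2 * θ₃) * r ^ τ * ‖xstar‖ := by
    have : 0 < c ^ (τ / p) := by positivity
    have : 0 < √(2 * θ₃) := by positivity
    rw [hs]
    field_simp
  have hfirst : (c ^ (τ / p) * r ^ τ) ^ (p / τ) / (p / τ) = θ₁' / 2 ^ (p + 1) * r ^ p := by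
    rw [Real.mul_rpow (by positivity) (by positivity), ← Real.rpow_mul hc0.le,
      ← Real.rpow_mul hr0.le, div_mul_div_cancel₀ hp0.ne', div_self hτ0.ne', Real.rpow_one,
      mul_div_cancel₀ _ hτ0.ne', hc]
    field_simp
  rw [hprod, hfirst, Real.div_rpow (norm_nonneg _) hs0.le, div_div] at hyoung
  have hmain : 2 * (θ₁' / 2 ^ (p + 1) * r ^ p) ≤ θ₁' * ‖x‖ ^ p := by
    calc 2 * (θ₁' / 2 ^ (p + 1) * r ^ p) = θ₁' * (r ^ p / 2 ^ p) := by
          rw [h2p]; field_simp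
      _ ≤ θ₁' * ‖x‖ ^ p := by gcongr
  rw [inner_sub_right]
  linarith [hdiss' x hx]
end

section
/- Let a₁, …, a_n ∈ ℝ^d, b₁, …, b_n ∈ ℝ, λ > 0, and define the regularized heavy-tailed MLE objective f(x) = (1/(2n))Σᵢ log(1 + (bᵢ − ⟨aᵢ, x⟩)²) + (λ/2)‖x‖². Then for every x ∈ ℝ^d, ⟨x, ∇f(x)⟩ ≥ λ‖x‖² − (1/n)Σᵢ|bᵢ|. -/
open scoped InnerProductSpace

/-- With residual `r = b - c`, the radial derivative of the Cauchy log-likelihood loss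
is bounded below by `-|b|`. -/
lemma neg_abs_le_residual_mul_div (b c : ℝ) :
    -|b| ≤ (b - c) * (-c) / (1 + (b - c) ^ 2) := by
  rw [le_div_iff₀ (by positivity)]
  have h₁ : (b - c) * b ≤ |b - c| * |b| := (le_abs_self _).trans (abs_mul _ _).le
  have h₂ : |b - c| ≤ 1 + (b - c) ^ 2 := by
    nlinarith [sq_abs (b - c), sq_nonneg (|b - c| - 1), abs_nonneg (b - c)]
  nlinarith [mul_le_mul_of_nonneg_right h₂ (abs_nonneg b), sq_nonneg (b - c)]

lemma hasDerivAt_log_one_add_residual_sq (b c t : ℝ) :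
    HasDerivAt (fun t : ℝ => Real.log (1 + (b - t * c) ^ 2))
      (2 * ((b - t * c) * (-c) / (1 + (b - t * c) ^ 2))) t := by
  have h := ((((hasDerivAt_id t).mul_const c).const_sub b).pow 2).const_add 1
  refine (h.log (by simp only [id, Pi.pow_apply]; positivity)).congr_deriv ?_
  simp
  ring

/-- The inner product of a point with the gradient there is the radial derivative. -/
lemma HasGradientAt.hasDerivAt_smul {E : Type*} [NormedAddCommGroup E] [InnerProductSpace ℝ E]
    [CompleteSpace E] {f : E → ℝ} {g x : E} (hf : HasGradientAt f g x) :
    HasDerivAt (fun t : ℝ => f (t • x)) ⟪x, g⟫_ℝ 1 := by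
  have hline : HasDerivAt (fun t : ℝ => t • x) x 1 := by
    simpa using (hasDerivAt_id (1 : ℝ)).smul_const x
  have hf' := hf.hasFDerivAt
  rw [← one_smul ℝ x] at hf'
  simpa [Function.comp_def, real_inner_comm] using hf'.comp_hasDerivAt (1 : ℝ) hline

/-- regularized MLE for heavy-tailed linear regression is
dissipative. For
`f x = (1/(2n)) ∑ i, log(1 + (b i - ⟨a i, x⟩)²) + (λ/2) ‖x‖²` with `λ > 0`,
one has `⟪x, ∇f x⟫ ≥ λ ‖x‖² - (1/n) ∑ i, |b i|` for every `x`. -/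
theorem heavy_tailed_mle_dissipative
    {n d : ℕ} (hn : 0 < n)
    (a : Fin n → EuclideanSpace ℝ (Fin d)) (b : Fin n → ℝ)
    (lam : ℝ) (hlam : 0 < lam)
    (f : EuclideanSpace ℝ (Fin d) → ℝ)
    (hfdef : ∀ x, f x =
      (1 / (2 * n)) * ∑ i, Real.log (1 + (b i - ⟪a i, x⟫_ℝ) ^ 2) + lam / 2 * ‖x‖ ^ 2)
    (f' : EuclideanSpace ℝ (Fin d) → EuclideanSpace ℝ (Fin d))
    (hf' : ∀ x, HasGradientAt f (f' x) x) :
    ∀ x, lam * ‖x‖ ^ 2 - (1 / n) * ∑ i, |b i| ≤ ⟪x, f' x⟫_ℝ := by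
  intro x
  have hradial : HasDerivAt (fun t : ℝ => f (t • x))
      ((1 / (2 * n)) * ∑ i, 2 * ((b i - 1 * ⟪a i, x⟫_ℝ) * (-⟪a i, x⟫_ℝ) /
        (1 + (b i - 1 * ⟪a i, x⟫_ℝ) ^ 2)) + lam / 2 * (2 * ‖x‖ ^ 2)) 1 := by
    have hfun : (fun t : ℝ => f (t • x)) = fun t : ℝ =>
        (1 / (2 * n)) * ∑ i, Real.log (1 + (b i - t * ⟪a i, x⟫_ℝ) ^ 2)
          + lam / 2 * (t ^ 2 * ‖x‖ ^ 2) := by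
      funext t
      simp only [hfdef, real_inner_smul_right, norm_smul, mul_pow, Real.norm_eq_abs, sq_abs]
    rw [hfun]
    have hsum := HasDerivAt.fun_sum (u := Finset.univ) fun i _ =>
      hasDerivAt_log_one_add_residual_sq (b i) ⟪a i, x⟫_ℝ 1
    have hsq : HasDerivAt (fun t : ℝ => t ^ 2 * ‖x‖ ^ 2) (2 * ‖x‖ ^ 2) 1 := by
      simpa using (hasDerivAt_pow 2 (1 : ℝ)).mul_const (‖x‖ ^ 2)
    exact (hsum.const_mul _).add (hsq.const_mul _)
  rw [(hf' x).hasDerivAt_smul.unique hradial, ← Finset.mul_sum]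
  have hsum : -∑ i, |b i| ≤ ∑ i, (b i - 1 * ⟪a i, x⟫_ℝ) * (-⟪a i, x⟫_ℝ) /
      (1 + (b i - 1 * ⟪a i, x⟫_ℝ) ^ 2) := by
    rw [← Finset.sum_neg_distrib]
    refine Finset.sum_le_sum fun i _ => ?_
    simpa only [one_mul] using neg_abs_le_residual_mul_div (b i) ⟪a i, x⟫_ℝ
  have hn' : (0 : ℝ) < n := Nat.cast_pos.mpr hn
  have hhalf : (1 / (2 * n) : ℝ) * 2 = 1 / n := by field_simp
  rw [← mul_assoc, hhalf]
  have hscaled := mul_le_mul_of_nonneg_left hsum (one_div_pos.mpr hn').le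
  linarith
end

section
/- Let a₁, …, a_n ∈ ℝ^d, b₁, …, b_n ∈ ℝ, λ > 0, and define the ℓ₁-regularized logistic objective f(x) = (1/n)Σᵢ log(1 + exp(−bᵢ⟨aᵢ, x⟩)) + λ‖x‖₁. Let g(x) = (1/n)Σᵢ (−bᵢaᵢ)·exp(−bᵢ⟨aᵢ, x⟩)/(1 + exp(−bᵢ⟨aᵢ, x⟩)) + λs(x), where s(x) ∈ ℝ^d is any vector with s(x)ⱼ = sgn(xⱼ) when xⱼ ≠ 0 and s(x)ⱼ ∈ [−1,1] otherwise (so g(x) is a subgradient of f at x). Then for every x ∈ ℝ^d, ⟨g(x), x⟩ ≥ λ‖x‖₁ − 1/2 ≥ λ‖x‖₂ − 1/2; i.e., f is generalized R-dissipative with θ₁ = λ, θ₂ = 1/2, R = 0, p = 1. -/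
open scoped InnerProductSpace

/-- The logistic derivative at `t`, multiplied by `t`, is at least `-1/2`. -/
lemma neg_half_le_logistic_mul (t : ℝ) :
    -(1 / 2) ≤ Real.exp t / (1 + Real.exp t) * t := by
  have hpos := Real.exp_pos t
  have hquad : -2 * t ≤ Real.exp (-t) + 1 := by
    rcases le_total 0 t with ht | ht
    · linarith [Real.exp_pos (-t)]
    · nlinarith [Real.quadratic_le_exp_of_nonneg (neg_nonneg.2 ht), sq_nonneg (t + 1)]
  have hmul : Real.exp (-t) * Real.exp t = 1 := by rw [← Real.exp_add]; simp
  rw [div_mul_eq_mul_div, le_div_iff₀ (by positivity)]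
  nlinarith [mul_le_mul_of_nonneg_right hquad hpos.le]

/-- The Euclidean norm is bounded by the `ℓ₁` norm. -/
lemma EuclideanSpace.norm_le_sum_abs {ι : Type*} [Fintype ι] (x : EuclideanSpace ℝ ι) :
    ‖x‖ ≤ ∑ j, |x j| := by
  rw [EuclideanSpace.norm_eq]
  refine Real.sqrt_le_iff.2 ⟨Finset.sum_nonneg fun j _ => abs_nonneg _, ?_⟩
  simpa only [Real.norm_eq_abs] using
    Finset.sum_sq_le_sq_sum_of_nonneg fun j _ => abs_nonneg (x j)

/-- Pairing a vector with a sign selection of it gives its `ℓ₁` norm. -/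
lemma inner_sign_selection {ι : Type*} [Fintype ι] {x s : EuclideanSpace ℝ ι}
    (hs : ∀ j, x j ≠ 0 → s j = Real.sign (x j)) : ⟪s, x⟫_ℝ = ∑ j, |x j| := by
  rw [PiLp.inner_apply]
  refine Finset.sum_congr rfl fun j _ => ?_
  by_cases hj : x j = 0
  · simp [hj]
  · rw [hs j hj, RCLike.inner_apply, conj_trivial]
    rcases lt_or_gt_of_ne hj with h | h
    · simp [Real.sign_of_neg h, abs_of_neg h]
    · simp [Real.sign_of_pos h, abs_of_pos h]

/-- ℓ₁-regularized logistic regression is generalized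
`R`-dissipative with `θ₁ = λ`, `θ₂ = 1/2`, `R = 0`, `p = 1`.
For `f x = (1/n) ∑ i, log(1 + exp(-b i ⟨a i, x⟩)) + λ ‖x‖₁` and the subgradient
`g x = (1/n) ∑ i, (-b i) exp(-b i ⟨a i, x⟩)/(1 + exp(-b i ⟨a i, x⟩)) • a i + λ • s x`
(with `s x` a sign selection of `x`), one has, for every `x`,
`⟪g x, x⟫ ≥ λ ‖x‖₁ - 1/2 ≥ λ ‖x‖₂ - 1/2`. -/
theorem l1_logistic_generalized_dissipative
    {n d : ℕ} (hn : 0 < n)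
    (a : Fin n → EuclideanSpace ℝ (Fin d)) (b : Fin n → ℝ)
    (lam : ℝ) (hlam : 0 < lam)
    (s : EuclideanSpace ℝ (Fin d) → EuclideanSpace ℝ (Fin d))
    (hs1 : ∀ x : EuclideanSpace ℝ (Fin d), ∀ j, x j ≠ 0 → s x j = Real.sign (x j))
    (hs2 : ∀ x : EuclideanSpace ℝ (Fin d), ∀ j, x j = 0 → s x j ∈ Set.Icc (-1 : ℝ) 1)
    (g : EuclideanSpace ℝ (Fin d) → EuclideanSpace ℝ (Fin d))
    (hg : ∀ x, g x =
      (n : ℝ)⁻¹ • ∑ i, (Real.exp (-(b i) * ⟪a i, x⟫_ℝ) /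
        (1 + Real.exp (-(b i) * ⟪a i, x⟫_ℝ))) • ((-(b i)) • a i) + lam • s x) :
    ∀ x : EuclideanSpace ℝ (Fin d),
      lam * (∑ j, |x j|) - 1 / 2 ≤ ⟪g x, x⟫_ℝ ∧
      lam * ‖x‖ - 1 / 2 ≤ lam * (∑ j, |x j|) - 1 / 2 := by
  intro x
  refine ⟨?_, by gcongr; exact EuclideanSpace.norm_le_sum_abs x⟩
  have hn' : (0 : ℝ) < n := Nat.cast_pos.2 hn
  rw [hg, inner_add_left, real_inner_smul_left, real_inner_smul_left,
    inner_sign_selection (hs1 x), sum_inner]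
  simp only [real_inner_smul_left]
  have hsum := Finset.card_nsmul_le_sum Finset.univ
    (fun i => Real.exp (-(b i) * ⟪a i, x⟫_ℝ) / (1 + Real.exp (-(b i) * ⟪a i, x⟫_ℝ)) *
      (-(b i) * ⟪a i, x⟫_ℝ)) (-(1 / 2)) fun i _ => neg_half_le_logistic_mul _
  rw [Finset.card_univ, Fintype.card_fin, nsmul_eq_mul] at hsum
  have hmean := (le_inv_mul_iff₀ hn').2 hsum
  linarith
end

section
/- Let f : ℝ^d → ℝ be L-smooth with global minimizer x* and satisfy ⟨x − x*, ∇f(x)⟩ ≥ θ₁‖x − x*‖² − θ₂ for all x ∈ ℝ^d, with θ₁ > 0, θ₂ ≥ 0. Consider SGD iterates x_{k+1} = x_k − η g_k with a stochastic gradient oracle with parameters ρ ≥ 0, σ ≥ 0 and constant step-size 0 < η ≤ θ₁/((1+ρ)L²). Then for every T ≥ 1, E[‖x_{T+1} − x*‖²] ≤ (1 − ηθ₁)^T ‖x₁ − x*‖² + (2θ₂ + ησ²)/θ₁. -/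
open MeasureTheory
open scoped InnerProductSpace

section Auxiliary

variable {E : Type*} [NormedAddCommGroup E] [InnerProductSpace ℝ E]

/-- The gradient vanishes at a local minimum. -/
theorem IsLocalMin.hasGradientAt_eq_zero [CompleteSpace E] {f : E → ℝ} {p a : E} (h : IsLocalMin f a)
    (hf : HasGradientAt f p a) : p = 0 := by
  simpa using h.hasFDerivAt_eq_zero hf.hasFDerivAt

/-- Bias-variance decomposition of the second moment with respect to a conditional expectation. -/
theorem integral_norm_sq_eq_condExp_add [CompleteSpace E] {Ω : Type*}
    {m m0 : MeasurableSpace Ω} {μ : Measure Ω} [IsFiniteMeasure μ] (hm : m ≤ m0) {Z : Ω → E} (hZ : MemLp Z 2 μ) :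
    ∫ ω, ‖Z ω‖ ^ 2 ∂μ = ∫ ω, ‖(μ[Z | m]) ω‖ ^ 2 ∂μ + ∫ ω, ‖Z ω - (μ[Z | m]) ω‖ ^ 2 ∂μ := by
  have hA : MemLp (μ[Z | m]) 2 μ := hZ.condExp one_le_two
  have hN : MemLp (Z - μ[Z | m]) 2 μ := hZ.sub hA
  have hA2 := (memLp_two_iff_integrable_sq_norm hA.1).1 hA
  have hN2 := (memLp_two_iff_integrable_sq_norm hN.1).1 hN
  have hI : Integrable (fun ω => innerSL ℝ ((μ[Z | m]) ω) ((Z - μ[Z | m]) ω)) μ := by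
    refine (hA.norm.integrable_mul hN.norm).mono' ?_ (ae_of_all _ fun ω => ?_)
    · exact hA.1.inner hN.1
    · exact norm_inner_le_norm _ _
  have hZi : Integrable Z μ := hZ.integrable one_le_two
  have hcond : μ[Z - μ[Z | m] | m] =ᵐ[μ] 0 := by
    refine (condExp_sub hZi integrable_condExp m).trans ?_
    rw [condExp_of_stronglyMeasurable hm stronglyMeasurable_condExp integrable_condExp, sub_self]
  have hzero : ∫ ω, innerSL ℝ ((μ[Z | m]) ω) ((Z - μ[Z | m]) ω) ∂μ = 0 := by
    rw [← integral_condExp hm]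
    refine integral_eq_zero_of_ae ?_
    filter_upwards [condExp_bilin_of_stronglyMeasurable_left (innerSL ℝ)
      stronglyMeasurable_condExp hI (hN.integrable one_le_two), hcond] with ω h1 h2
    rw [h1, h2]
    simp
  have hexp : ∀ ω, ‖Z ω‖ ^ 2 = ‖(μ[Z | m]) ω‖ ^ 2
      + 2 * innerSL ℝ ((μ[Z | m]) ω) ((Z - μ[Z | m]) ω) + ‖(Z - μ[Z | m]) ω‖ ^ 2 := fun ω => by
    have := norm_add_sq_real ((μ[Z | m]) ω) ((Z - μ[Z | m]) ω)
    simpa using this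
  simp_rw [hexp]
  have hA2I : Integrable (fun ω => ‖(μ[Z | m]) ω‖ ^ 2
      + 2 * innerSL ℝ ((μ[Z | m]) ω) ((Z - μ[Z | m]) ω)) μ := hA2.add (hI.const_mul 2)
  rw [integral_add hA2I hN2, integral_add hA2 (hI.const_mul 2), integral_const_mul, hzero]
  simp

/-- A dissipative field of linear growth `L` has dissipativity constant at most `L`. -/
theorem dissipative_const_le [Nontrivial E] {F : E → E} {a : E} {L θ₁ θ₂ : ℝ}
    (hgrowth : ∀ y, ‖F y‖ ≤ L * ‖y - a‖)
    (hdiss : ∀ y, θ₁ * ‖y - a‖ ^ 2 - θ₂ ≤ ⟪y - a, F y⟫_ℝ) (hθ₂ : 0 ≤ θ₂) : θ₁ ≤ L := by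
  by_contra! hlt
  have hpos : 0 < θ₁ - L := sub_pos.2 hlt
  obtain ⟨v, hv⟩ := exists_norm_eq E (Real.sqrt_nonneg ((θ₂ + 1) / (θ₁ - L)))
  have hsq : (θ₁ - L) * ‖v‖ ^ 2 = θ₂ + 1 := by
    rw [hv, Real.sq_sqrt (by positivity)]
    field_simp
  have h1 := hdiss (a + v)
  have h2 := hgrowth (a + v)
  rw [add_sub_cancel_left] at h1 h2
  have h3 := real_inner_le_norm v (F (a + v))
  nlinarith [mul_le_mul_of_nonneg_left h2 (norm_nonneg v)]

/-- Dissipativity bounds the distance to the center by the norm of the field. -/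
theorem norm_le_of_dissipative {y p : E} {θ₁ θ₂ : ℝ} (hθ₁ : 0 < θ₁) (hθ₂ : 0 ≤ θ₂)
    (h : θ₁ * ‖y‖ ^ 2 - θ₂ ≤ ⟪y, p⟫_ℝ) : ‖y‖ ≤ θ₁⁻¹ * (‖p‖ + θ₂) + 1 := by
  rcases le_total ‖y‖ 1 with hy | hy
  · have : 0 ≤ θ₁⁻¹ * (‖p‖ + θ₂) := by positivity
    linarith
  · have h1 := real_inner_le_norm y p
    have h2 : θ₁ * ‖y‖ ≤ ‖p‖ + θ₂ := by
      refine le_of_mul_le_mul_left ?_ (zero_lt_one.trans_le hy)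
      nlinarith
    have h3 : ‖y‖ ≤ θ₁⁻¹ * (‖p‖ + θ₂) := by
      rwa [inv_mul_eq_div, le_div_iff₀ hθ₁, mul_comm]
    linarith

/-- One-step contraction of a stochastic gradient step along a dissipative field, with `v` the
conditional variance of the noise. -/
theorem norm_sub_smul_sq_add_le {y p : E} {L θ₁ θ₂ ρ σ η v : ℝ} (hL : 0 < L) (hρ : 0 ≤ ρ)
    (hη : 0 < η) (hηle : η ≤ θ₁ / ((1 + ρ) * L ^ 2)) (hp : ‖p‖ ≤ L * ‖y‖)
    (h : θ₁ * ‖y‖ ^ 2 - θ₂ ≤ ⟪y, p⟫_ℝ) (hv : v ≤ ρ * ‖p‖ ^ 2 + σ ^ 2) :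
    ‖y - η • p‖ ^ 2 + η ^ 2 * v ≤ (1 - η * θ₁) * ‖y‖ ^ 2 + η * (2 * θ₂ + η * σ ^ 2) := by
  rw [norm_sub_sq_real, inner_smul_right, norm_smul, mul_pow, Real.norm_eq_abs, sq_abs]
  have h1 : η * ((1 + ρ) * L ^ 2) ≤ θ₁ := (le_div_iff₀ (by positivity)).1 hηle
  have h2 : ‖p‖ ^ 2 ≤ L ^ 2 * ‖y‖ ^ 2 := by
    rw [← mul_pow]
    gcongr
  have h3 : η ^ 2 * v ≤ η ^ 2 * (ρ * ‖p‖ ^ 2 + σ ^ 2) := by gcongr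
  have h4 : η ^ 2 * (1 + ρ) * ‖p‖ ^ 2 ≤ η ^ 2 * (1 + ρ) * (L ^ 2 * ‖y‖ ^ 2) := by gcongr
  have h5 : η * ‖y‖ ^ 2 * (η * ((1 + ρ) * L ^ 2)) ≤ η * ‖y‖ ^ 2 * θ₁ := by gcongr
  have h6 := mul_le_mul_of_nonneg_left h hη.le
  linarith

/-- If the explicit gradient step `y - η • p` is in `L^q` and `η * L < 1`, then so is `y`. -/
theorem memLp_of_sub_smul {Ω : Type*} {m0 : MeasurableSpace Ω} {μ : Measure Ω}
    {y p : Ω → E} {q : ENNReal} {L η : ℝ} (hη : 0 ≤ η) (hηL : η * L < 1)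
    (hy : AEStronglyMeasurable y μ) (hp : ∀ ω, ‖p ω‖ ≤ L * ‖y ω‖)
    (h : MemLp (fun ω => y ω - η • p ω) q μ) : MemLp y q μ := by
  refine h.of_le_mul (c := (1 - η * L)⁻¹) hy (ae_of_all _ fun ω => ?_)
  have hpos : 0 < 1 - η * L := by linarith
  rw [inv_mul_eq_div, le_div_iff₀ hpos]
  have h1 := norm_sub_norm_le (y ω) (η • p ω)
  rw [norm_smul, Real.norm_of_nonneg hη] at h1
  nlinarith [mul_le_mul_of_nonneg_left (hp ω) hη]

end Auxiliary

/-- Theorem D.2, SGD under global dissipativity, constant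
step-size. Under `L`-smoothness and dissipativity on all of `ℝ^d`, SGD with
constant step-size `0 < η ≤ θ₁/((1+ρ)L²)` satisfies, for every `T ≥ 1`,
`E[‖x (T+1) - x*‖²] ≤ (1 - η θ₁)^T ‖x₁ - x*‖² + (2θ₂ + η σ²)/θ₁`. -/
theorem sgd_global_dissipative_constant_step
    {d : ℕ} {Ω : Type*} [m0 : MeasurableSpace Ω] (μ : Measure Ω) [IsProbabilityMeasure μ]
    (ℱ : ℕ → MeasurableSpace Ω) (hℱ : ∀ k, ℱ k ≤ m0)
    (f : EuclideanSpace ℝ (Fin d) → ℝ)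
    (f' : EuclideanSpace ℝ (Fin d) → EuclideanSpace ℝ (Fin d))
    (hf : ∀ y, HasGradientAt f (f' y) y)
    (L : ℝ) (hL : 0 < L)
    (hsmooth : ∀ y z, ‖f' y - f' z‖ ≤ L * ‖y - z‖)
    (xstar : EuclideanSpace ℝ (Fin d)) (hmin : ∀ y, f xstar ≤ f y)
    (θ₁ θ₂ : ℝ) (hθ₁ : 0 < θ₁) (hθ₂ : 0 ≤ θ₂)
    (hdiss : ∀ y, θ₁ * ‖y - xstar‖ ^ 2 - θ₂ ≤ ⟪y - xstar, f' y⟫_ℝ)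
    (ρ σ : ℝ) (hρ : 0 ≤ ρ) (hσ : 0 ≤ σ)
    (x g : ℕ → Ω → EuclideanSpace ℝ (Fin d))
    (hmeas : ∀ k, StronglyMeasurable[ℱ k] (x k))
    (hg : ∀ k, μ[g k | ℱ k] =ᵐ[μ] fun ω => f' (x k ω))
    (hvar : ∀ k, ∀ᵐ ω ∂μ,
      (μ[fun ω' => ‖g k ω' - f' (x k ω')‖ ^ 2 | ℱ k]) ω ≤ ρ * ‖f' (x k ω)‖ ^ 2 + σ ^ 2)
    (η : ℝ) (hη : 0 < η) (hηle : η ≤ θ₁ / ((1 + ρ) * L ^ 2))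
    (hx : ∀ k ω, x (k + 1) ω = x k ω - η • g k ω)
    (x1 : EuclideanSpace ℝ (Fin d)) (hx1 : ∀ ω, x 1 ω = x1) :
    ∀ T : ℕ, 1 ≤ T →
      (∫ ω, ‖x (T + 1) ω - xstar‖ ^ 2 ∂μ) ≤
        (1 - η * θ₁) ^ T * ‖x1 - xstar‖ ^ 2 + (2 * θ₂ + η * σ ^ 2) / θ₁ := by
  have hstar : f' xstar = 0 :=
    IsLocalMin.hasGradientAt_eq_zero (Filter.Eventually.of_forall hmin) (hf xstar)
  have hgrowth : ∀ y, ‖f' y‖ ≤ L * ‖y - xstar‖ := fun y => by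
    simpa [hstar] using hsmooth y xstar
  rcases subsingleton_or_nontrivial (EuclideanSpace ℝ (Fin d)) with hsub | hnon
  · intro T _
    have hz : ∀ v : EuclideanSpace ℝ (Fin d), ‖v‖ = 0 := fun v => by
      rw [Subsingleton.elim v 0, norm_zero]
    simp only [hz]
    simp
    positivity
  have hθL : θ₁ ≤ L := dissipative_const_le hgrowth hdiss hθ₂
  have hηL : η * L ^ 2 ≤ θ₁ := by
    have h1 : η * ((1 + ρ) * L ^ 2) ≤ θ₁ := (le_div_iff₀ (by positivity)).1 hηle
    have h2 : 0 ≤ η * (ρ * L ^ 2) := by positivity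
    linarith
  have hηL1 : η * L ≤ 1 := by
    refine le_of_mul_le_mul_right ?_ hL
    linarith
  have hηθ : η * θ₁ ≤ 1 := (mul_le_mul_of_nonneg_left hθL hη.le).trans hηL1
  have hstrict : η * θ₁ ≠ 1 → η * L < 1 := fun hne => by
    refine lt_of_le_of_ne hηL1 fun heq => hne ?_
    have : L ≤ θ₁ := by nlinarith
    rw [le_antisymm hθL this, heq]
  have hsm : ∀ k, AEStronglyMeasurable (x k) μ := fun k =>
    ((hmeas k).mono (hℱ k)).aestronglyMeasurable
  have hpint : ∀ k, Integrable (fun ω => f' (x k ω)) μ := fun k =>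
    integrable_condExp.congr (hg k)
  have hyint : ∀ k, Integrable (fun ω => x k ω - xstar) μ := fun k => by
    refine Integrable.mono' ((((hpint k).norm.add (integrable_const θ₂)).const_mul θ₁⁻¹).add
      (integrable_const 1)) ((hsm k).sub aestronglyMeasurable_const) (ae_of_all _ fun ω => ?_)
    exact norm_le_of_dissipative hθ₁ hθ₂ (hdiss (x k ω))
  have hgint : ∀ k, Integrable (g k) μ := fun k => by
    have heq : g k = fun ω => η⁻¹ • ((x k ω - xstar) - (x (k + 1) ω - xstar)) := by
      funext ω
      rw [hx k ω]
      simp [smul_smul, hη.ne']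
    rw [heq]
    exact ((hyint k).sub (hyint (k + 1))).smul η⁻¹
  have hstep : ∀ k, MemLp (fun ω => x (k + 1) ω - xstar) 2 μ →
      ∫ ω, ‖x (k + 1) ω - xstar‖ ^ 2 ∂μ ≤
        (1 - η * θ₁) * ∫ ω, ‖x k ω - xstar‖ ^ 2 ∂μ + η * (2 * θ₂ + η * σ ^ 2) := by
    intro k hZ
    set Z : Ω → EuclideanSpace ℝ (Fin d) := fun ω => x (k + 1) ω - xstar with hZdef
    have hcond : μ[Z | ℱ k] =ᵐ[μ] fun ω => (x k ω - xstar) - η • f' (x k ω) := by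
      have heq : Z = (fun ω => x k ω - xstar) - η • g k := by
        funext ω
        simp [hZdef, hx k ω]
        abel
      rw [heq]
      have hy : μ[fun ω => x k ω - xstar | ℱ k] = fun ω => x k ω - xstar :=
        condExp_of_stronglyMeasurable (hℱ k) ((hmeas k).sub stronglyMeasurable_const) (hyint k)
      filter_upwards [condExp_sub (hyint k) ((hgint k).smul η) (ℱ k),
        condExp_smul η (g k) (ℱ k) (μ := μ), hg k] with ω h1 h2 h3
      rw [h1, Pi.sub_apply, h2, Pi.smul_apply, h3, hy]
    have hA : MemLp (fun ω => (x k ω - xstar) - η • f' (x k ω)) 2 μ :=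
      (hZ.condExp one_le_two).ae_eq hcond
    have hnoise : ∀ ω, Z ω - ((x k ω - xstar) - η • f' (x k ω)) =
        -(η • (g k ω - f' (x k ω))) := fun ω => by
      simp only [hZdef, hx k ω, smul_sub]
      abel
    have hdecomp : ∫ ω, ‖Z ω‖ ^ 2 ∂μ = ∫ ω, (‖(x k ω - xstar) - η • f' (x k ω)‖ ^ 2 +
        η ^ 2 * (μ[fun ω' => ‖g k ω' - f' (x k ω')‖ ^ 2 | ℱ k]) ω) ∂μ := by
      rw [integral_norm_sq_eq_condExp_add (hℱ k) hZ,
        integral_add ((memLp_two_iff_integrable_sq_norm hA.1).1 hA)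
          (integrable_condExp.const_mul _), integral_const_mul, integral_condExp (hℱ k),
        ← integral_const_mul]
      congr 1
      · refine integral_congr_ae ?_
        filter_upwards [hcond] with ω h
        rw [h]
      · refine integral_congr_ae ?_
        filter_upwards [hcond] with ω h
        rw [h, hnoise, norm_neg, norm_smul, mul_pow, Real.norm_eq_abs, sq_abs]
    have hbound : Integrable (fun ω => (1 - η * θ₁) * ‖x k ω - xstar‖ ^ 2) μ := by
      by_cases hone : η * θ₁ = 1
      · simp [hone]
      · have hy := memLp_of_sub_smul hη.le (hstrict hone) (hyint k).1
          (fun ω => hgrowth (x k ω)) hA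
        exact ((memLp_two_iff_integrable_sq_norm hy.1).1 hy).const_mul _
    calc ∫ ω, ‖Z ω‖ ^ 2 ∂μ
        ≤ ∫ ω, ((1 - η * θ₁) * ‖x k ω - xstar‖ ^ 2 + η * (2 * θ₂ + η * σ ^ 2)) ∂μ := by
          rw [hdecomp]
          refine integral_mono_ae (((memLp_two_iff_integrable_sq_norm hA.1).1 hA).add
            (integrable_condExp.const_mul _)) (hbound.add (integrable_const _)) ?_
          filter_upwards [hvar k] with ω h
          exact norm_sub_smul_sq_add_le hL hρ hη hηle (hgrowth _) (hdiss _) h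
      _ = (1 - η * θ₁) * ∫ ω, ‖x k ω - xstar‖ ^ 2 ∂μ + η * (2 * θ₂ + η * σ ^ 2) := by
          rw [integral_add hbound (integrable_const _), integral_const_mul]
          simp
  have ha : 0 ≤ 1 - η * θ₁ := by linarith
  have main : ∀ T : ℕ, (∫ ω, ‖x (T + 1) ω - xstar‖ ^ 2 ∂μ) ≤
      (1 - η * θ₁) ^ T * ‖x1 - xstar‖ ^ 2 + (2 * θ₂ + η * σ ^ 2) / θ₁ := by
    intro T
    induction T with
    | zero =>
      have : 0 ≤ (2 * θ₂ + η * σ ^ 2) / θ₁ := by positivity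
      simpa [hx1] using this
    | succ n ih =>
      by_cases hZ : MemLp (fun ω => x (n + 1 + 1) ω - xstar) 2 μ
      · refine (hstep (n + 1) hZ).trans ?_
        have h1 := mul_le_mul_of_nonneg_left ih ha
        have h2 : η * (2 * θ₂ + η * σ ^ 2) = η * θ₁ * ((2 * θ₂ + η * σ ^ 2) / θ₁) := by
          field_simp
        rw [pow_succ (1 - η * θ₁), h2]
        linarith
      · rw [memLp_two_iff_integrable_sq_norm (hyint _).1] at hZ
        rw [integral_undef hZ]
        positivity
  exact fun T _ => main T
end

section
/- Let f : ℝ^d → ℝ be L-smooth with global minimizer x* and satisfy ⟨x − x*, ∇f(x)⟩ ≥ θ₁‖x − x*‖² − θ₂ for all x ∈ ℝ^d, with θ₁ > 0, θ₂ ≥ 0. Consider SGD iterates x_{k+1} = x_k − η_k g_k with a stochastic gradient oracle with parameters ρ ≥ 0, σ ≥ 0 and harmonically decaying step-sizes η_k = η₁/k satisfying η₁ ≤ θ₁/((1+ρ)L²). Then for every T ≥ 1, E[‖x_{T+1} − x*‖²] ≤ ‖x₁ − x*‖²/(T+1)^{θ₁η₁} + 2(2θ₂ + η₁σ²)/θ₁.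 -/
open MeasureTheory
open scoped InnerProductSpace

/-- One step of SGD with a square-integrable oracle: expected squared distance recursion. -/
lemma integral_norm_sub_sq_sgd_step_le {Ω E : Type*} [NormedAddCommGroup E]
    [InnerProductSpace ℝ E] [CompleteSpace E] {m m0 : MeasurableSpace Ω} {μ : Measure Ω}
    [IsProbabilityMeasure μ] (hm : m ≤ m0) {G : E → E} {z : E} {L θ₁ θ₂ ρ σ η : ℝ}
    (hG : Continuous G) (hGL : ∀ y, ‖G y‖ ≤ L * ‖y - z‖)
    (hdiss : ∀ y, θ₁ * ‖y - z‖ ^ 2 - θ₂ ≤ ⟪y - z, G y⟫_ℝ) (hρ : 0 ≤ ρ) (hη : 0 ≤ η)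
    {X g : Ω → E} (hX : StronglyMeasurable[m] X) (hX2 : MemLp (fun ω => X ω - z) 2 μ)
    (hg2 : MemLp g 2 μ) (hg : μ[g | m] =ᵐ[μ] fun ω => G (X ω))
    (hvar : ∀ᵐ ω ∂μ,
      (μ[fun ω' => ‖g ω' - G (X ω')‖ ^ 2 | m]) ω ≤ ρ * ‖G (X ω)‖ ^ 2 + σ ^ 2) :
    ∫ ω, ‖X ω - η • g ω - z‖ ^ 2 ∂μ ≤
      (1 - 2 * η * θ₁ + η ^ 2 * ((1 + ρ) * L ^ 2)) * ∫ ω, ‖X ω - z‖ ^ 2 ∂μ +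
        2 * η * θ₂ + η ^ 2 * σ ^ 2 := by
  have hGX : StronglyMeasurable[m] fun ω => G (X ω) := hG.comp_stronglyMeasurable hX
  have hGX2 : MemLp (fun ω => G (X ω)) 2 μ :=
    hX2.of_le_mul (hGX.mono hm).aestronglyMeasurable (ae_of_all _ fun ω => hGL (X ω))
  have hn2 : MemLp (fun ω => g ω - G (X ω)) 2 μ := hg2.sub hGX2
  have hu2 : MemLp (fun ω => X ω - z - η • G (X ω)) 2 μ := hX2.sub (hGX2.const_smul η)
  have hu : StronglyMeasurable[m] fun ω => X ω - z - η • G (X ω) :=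
    (hX.sub stronglyMeasurable_const).sub (hGX.const_smul η)
  have hcross_int : Integrable (fun ω => ⟪X ω - z - η • G (X ω), g ω - G (X ω)⟫_ℝ) μ := by
    refine (hu2.norm.integrable_mul hn2.norm).mono' (hu2.1.inner hn2.1) (ae_of_all _ fun ω => ?_)
    exact norm_inner_le_norm _ _
  have hnoise : μ[fun ω => g ω - G (X ω) | m] =ᵐ[μ] 0 := by
    have h := condExp_sub (hg2.integrable one_le_two) (hGX2.integrable one_le_two) m
    filter_upwards [h, hg] with ω h1 h2
    have h3 := condExp_of_stronglyMeasurable hm hGX (hGX2.integrable one_le_two)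
    change (μ[g - fun ω => G (X ω) | m]) ω = 0
    rw [h1, Pi.sub_apply, h2, h3, sub_self]
  have hcross : ∫ ω, ⟪X ω - z - η • G (X ω), g ω - G (X ω)⟫_ℝ ∂μ = 0 := by
    have h := condExp_bilin_of_stronglyMeasurable_left (innerSL ℝ) hu hcross_int
      (hn2.integrable one_le_two)
    rw [← integral_condExp hm]
    refine integral_eq_zero_of_ae ?_
    filter_upwards [h, hnoise] with ω h1 h2
    refine h1.trans ?_
    rw [h2]
    simp
  have hG_int : Integrable (fun ω => ‖G (X ω)‖ ^ 2) μ := hGX2.integrable_norm_pow two_ne_zero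
  have hX_int : Integrable (fun ω => ‖X ω - z‖ ^ 2) μ := hX2.integrable_norm_pow two_ne_zero
  have hn_int : Integrable (fun ω => ‖g ω - G (X ω)‖ ^ 2) μ :=
    hn2.integrable_norm_pow two_ne_zero
  have hu_int : Integrable (fun ω => ‖X ω - z - η • G (X ω)‖ ^ 2) μ :=
    hu2.integrable_norm_pow two_ne_zero
  have hvar' : ∫ ω, ‖g ω - G (X ω)‖ ^ 2 ∂μ ≤ ρ * ∫ ω, ‖G (X ω)‖ ^ 2 ∂μ + σ ^ 2 := by
    rw [← integral_condExp hm]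
    refine (integral_mono_ae integrable_condExp
      ((hG_int.const_mul ρ).add (integrable_const (σ ^ 2))) hvar).trans_eq ?_
    simp only [Pi.add_apply]
    rw [integral_add (hG_int.const_mul ρ) (integrable_const _), integral_const_mul]
    simp
  have hexpand : ∫ ω, ‖X ω - η • g ω - z‖ ^ 2 ∂μ =
      ∫ ω, ‖X ω - z - η • G (X ω)‖ ^ 2 ∂μ + η ^ 2 * ∫ ω, ‖g ω - G (X ω)‖ ^ 2 ∂μ := by
    have h : ∀ ω, ‖X ω - η • g ω - z‖ ^ 2 =
        ‖X ω - z - η • G (X ω)‖ ^ 2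
          - 2 * η * ⟪X ω - z - η • G (X ω), g ω - G (X ω)⟫_ℝ
          + η ^ 2 * ‖g ω - G (X ω)‖ ^ 2 := fun ω => by
      have h1 : X ω - η • g ω - z = (X ω - z - η • G (X ω)) - η • (g ω - G (X ω)) := by
        rw [smul_sub]; abel
      rw [h1, norm_sub_sq_real, real_inner_smul_right, norm_smul, mul_pow, Real.norm_eq_abs,
        sq_abs]
      ring
    have hdiff_int : Integrable (fun ω => ‖X ω - z - η • G (X ω)‖ ^ 2
        - 2 * η * ⟪X ω - z - η • G (X ω), g ω - G (X ω)⟫_ℝ) μ :=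
      hu_int.sub (hcross_int.const_mul _)
    simp_rw [h]
    rw [integral_add hdiff_int (hn_int.const_mul _),
      integral_sub hu_int (hcross_int.const_mul _), integral_const_mul, integral_const_mul,
      hcross]
    ring
  have hdrift : ∫ ω, ‖X ω - z - η • G (X ω)‖ ^ 2 ∂μ ≤
      (1 - 2 * η * θ₁) * ∫ ω, ‖X ω - z‖ ^ 2 ∂μ + 2 * η * θ₂
        + η ^ 2 * ∫ ω, ‖G (X ω)‖ ^ 2 ∂μ := by
    refine (integral_mono hu_int (((hX_int.const_mul (1 - 2 * η * θ₁)).add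
      (integrable_const (2 * η * θ₂))).add (hG_int.const_mul (η ^ 2))) fun ω => ?_).trans_eq ?_
    · simp only [Pi.add_apply]
      rw [norm_sub_sq_real, real_inner_smul_right, norm_smul, mul_pow, Real.norm_eq_abs, sq_abs]
      have := mul_le_mul_of_nonneg_left (hdiss (X ω)) hη
      linarith
    · simp only [Pi.add_apply]
      rw [integral_add ((hX_int.const_mul _).fun_add (integrable_const _)) (hG_int.const_mul _),
        integral_add (hX_int.const_mul _) (integrable_const _), integral_const_mul,
        integral_const_mul (η ^ 2)]
      simp
  have hGle : ∫ ω, ‖G (X ω)‖ ^ 2 ∂μ ≤ L ^ 2 * ∫ ω, ‖X ω - z‖ ^ 2 ∂μ := by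
    rw [← integral_const_mul]
    refine integral_mono hG_int (hX_int.const_mul _) fun ω => ?_
    simp only
    rw [← mul_pow]
    exact pow_le_pow_left₀ (norm_nonneg _) (hGL _) 2
  have h1 := mul_le_mul_of_nonneg_left hvar' (sq_nonneg η)
  have h2 := mul_le_mul_of_nonneg_left hGle (by positivity : 0 ≤ η ^ 2 * (1 + ρ))
  rw [hexpand]
  linarith

/-- If an SGD step lands in `L²` and the step size is below `1 / L`, then the step started
in `L²`. -/
lemma memLp_two_of_sgd_step {Ω E : Type*} [NormedAddCommGroup E]
    [InnerProductSpace ℝ E] [CompleteSpace E] {m m0 : MeasurableSpace Ω} {μ : Measure Ω}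
    [IsProbabilityMeasure μ] (hm : m ≤ m0) {G : E → E} {z : E} {L θ₁ θ₂ η : ℝ}
    (hGL : ∀ y, ‖G y‖ ≤ L * ‖y - z‖) (hθ₁ : 0 < θ₁)
    (hdiss : ∀ y, θ₁ * ‖y - z‖ ^ 2 - θ₂ ≤ ⟪y - z, G y⟫_ℝ) (hη : 0 ≤ η) (hηL : η * L < 1)
    {X g : Ω → E} (hX : StronglyMeasurable[m] X) (hg : μ[g | m] =ᵐ[μ] fun ω => G (X ω))
    (hY : MemLp (fun ω => X ω - η • g ω - z) 2 μ) :
    MemLp (fun ω => X ω - z) 2 μ := by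
  have hXm : AEStronglyMeasurable (fun ω => X ω - z) μ :=
    ((hX.mono hm).sub stronglyMeasurable_const).aestronglyMeasurable
  by_cases hgi : Integrable g μ
  · have hXi : Integrable (fun ω => X ω - z) μ := by
      refine ((hY.integrable one_le_two).add (hgi.smul η)).congr (ae_of_all _ fun ω => ?_)
      simp only [Pi.add_apply, Pi.smul_apply]
      abel
    have hcond : μ[fun ω => X ω - η • g ω - z | m] =ᵐ[μ]
        fun ω => X ω - z - η • G (X ω) := by
      have heq : (fun ω => X ω - η • g ω - z) = (fun ω => X ω - z) - η • g := by
        ext1 ω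
        simp only [Pi.sub_apply, Pi.smul_apply]
        abel
      rw [heq]
      have h3 := condExp_of_stronglyMeasurable hm (hX.sub stronglyMeasurable_const) hXi
      filter_upwards [condExp_sub hXi (hgi.smul η) m, condExp_smul η g m, hg] with ω h1 h2 h4
      rw [h1, Pi.sub_apply, h2, Pi.smul_apply, h4]
      exact congrArg (fun v => v - η • G (X ω)) (congrFun h3 ω)
    refine (hY.condExp (m := m) one_le_two).of_le_mul (c := (1 - η * L)⁻¹) hXm ?_
    filter_upwards [hcond] with ω hω
    rw [hω, ← div_eq_inv_mul, le_div_iff₀ (by linarith)]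
    have h1 := norm_sub_norm_le (X ω - z) (η • G (X ω))
    rw [norm_smul, Real.norm_of_nonneg hη] at h1
    have h2 := mul_le_mul_of_nonneg_left (hGL (X ω)) hη
    linarith
  · rw [condExp_of_not_integrable hgi] at hg
    refine MemLp.of_bound hXm (Real.sqrt (θ₂ / θ₁)) ?_
    filter_upwards [hg] with ω hω
    have h := hdiss (X ω)
    rw [← hω, Pi.zero_apply, inner_zero_right] at h
    refine Real.le_sqrt_of_sq_le ?_
    rw [le_div_iff₀ hθ₁]
    linarith

/-- In a nontrivial space, the dissipativity constant is at most the linear growth constant. -/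
lemma dissipativity_const_le {E : Type*} [NormedAddCommGroup E] [InnerProductSpace ℝ E]
    [Nontrivial E] {G : E → E} {z : E} {L θ₁ θ₂ : ℝ} (hGL : ∀ y, ‖G y‖ ≤ L * ‖y - z‖)
    (hθ₂ : 0 ≤ θ₂) (hdiss : ∀ y, θ₁ * ‖y - z‖ ^ 2 - θ₂ ≤ ⟪y - z, G y⟫_ℝ) : θ₁ ≤ L := by
  by_contra! h
  obtain ⟨v, hv⟩ := exists_norm_eq E (Real.sqrt_nonneg ((θ₂ + 1) / (θ₁ - L)))
  have h1 := hdiss (z + v)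
  have h2 := hGL (z + v)
  have h3 := real_inner_le_norm v (G (z + v))
  rw [add_sub_cancel_left] at h1 h2
  have h4 := mul_le_mul_of_nonneg_left h2 (norm_nonneg v)
  have h5 : ‖v‖ ^ 2 = (θ₂ + 1) / (θ₁ - L) := by
    rw [hv, Real.sq_sqrt (div_nonneg (by linarith) (by linarith))]
  rw [eq_div_iff (by linarith)] at h5
  linarith

lemma one_sub_div_mul_inv_rpow_le {a t : ℝ} (ha : 0 ≤ a) (ht : 0 < t) :
    (1 - a / t) * (t ^ a)⁻¹ ≤ ((t + 1) ^ a)⁻¹ := by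
  have h1 : 1 - a / t ≤ Real.exp (-(a / t)) := by
    linarith [Real.add_one_le_exp (-(a / t))]
  have h2 : ((t + 1) / t) ^ a ≤ Real.exp (a / t) := by
    have h : (t + 1) / t ≤ Real.exp (1 / t) := by
      have := Real.add_one_le_exp (1 / t)
      rwa [add_div, div_self ht.ne', add_comm]
    refine (Real.rpow_le_rpow (by positivity) h ha).trans_eq ?_
    rw [← Real.exp_mul]
    congr 1
    ring
  rw [Real.div_rpow (by positivity) ht.le] at h2
  have hpos : 0 < (t + 1) ^ a := by positivity
  have hpos' : 0 < t ^ a := by positivity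
  rw [← div_eq_mul_inv, ← one_div, div_le_div_iff₀ hpos' hpos, one_mul]
  rw [div_le_iff₀ hpos'] at h2
  calc (1 - a / t) * (t + 1) ^ a ≤ Real.exp (-(a / t)) * (Real.exp (a / t) * t ^ a) := by gcongr
    _ = t ^ a := by rw [← mul_assoc, ← Real.exp_add]; simp

/-- Theorem D.3, SGD under global dissipativity, harmonically
decaying step-size `η k = η₁/k`. Under `L`-smoothness and dissipativity on
all of `ℝ^d`, with `η₁ ≤ θ₁/((1+ρ)L²)`, for every `T ≥ 1`,
`E[‖x (T+1) - x*‖²] ≤ ‖x₁ - x*‖²/(T+1)^{θ₁ η₁} + 2(2θ₂ + η₁ σ²)/θ₁`. -/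
theorem sgd_global_dissipative_harmonic_step
    {d : ℕ} {Ω : Type*} [m0 : MeasurableSpace Ω] (μ : Measure Ω) [IsProbabilityMeasure μ]
    (ℱ : ℕ → MeasurableSpace Ω) (hℱ : ∀ k, ℱ k ≤ m0)
    (f : EuclideanSpace ℝ (Fin d) → ℝ)
    (f' : EuclideanSpace ℝ (Fin d) → EuclideanSpace ℝ (Fin d))
    (hf : ∀ y, HasGradientAt f (f' y) y)
    (L : ℝ) (hL : 0 < L)
    (hsmooth : ∀ y z, ‖f' y - f' z‖ ≤ L * ‖y - z‖)
    (xstar : EuclideanSpace ℝ (Fin d)) (hmin : ∀ y, f xstar ≤ f y)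
    (θ₁ θ₂ : ℝ) (hθ₁ : 0 < θ₁) (hθ₂ : 0 ≤ θ₂)
    (hdiss : ∀ y, θ₁ * ‖y - xstar‖ ^ 2 - θ₂ ≤ ⟪y - xstar, f' y⟫_ℝ)
    (ρ σ : ℝ) (hρ : 0 ≤ ρ) (hσ : 0 ≤ σ)
    (x g : ℕ → Ω → EuclideanSpace ℝ (Fin d))
    (hmeas : ∀ k, StronglyMeasurable[ℱ k] (x k))
    (hg : ∀ k, μ[g k | ℱ k] =ᵐ[μ] fun ω => f' (x k ω))
    (hvar : ∀ k, ∀ᵐ ω ∂μ,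
      (μ[fun ω' => ‖g k ω' - f' (x k ω')‖ ^ 2 | ℱ k]) ω ≤ ρ * ‖f' (x k ω)‖ ^ 2 + σ ^ 2)
    (η : ℕ → ℝ) (η₁ : ℝ) (hη₁pos : 0 < η₁) (hη₁le : η₁ ≤ θ₁ / ((1 + ρ) * L ^ 2))
    (hηdef : ∀ k, 1 ≤ k → η k = η₁ / k)
    (hx : ∀ k ω, 1 ≤ k → x (k + 1) ω = x k ω - η k • g k ω)
    (x1 : EuclideanSpace ℝ (Fin d)) (hx1 : ∀ ω, x 1 ω = x1) :
    ∀ T : ℕ, 1 ≤ T →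
      (∫ ω, ‖x (T + 1) ω - xstar‖ ^ 2 ∂μ) ≤
        ‖x1 - xstar‖ ^ 2 / ((T : ℝ) + 1) ^ (θ₁ * η₁) +
          2 * (2 * θ₂ + η₁ * σ ^ 2) / θ₁ := by
  have hstar : f' xstar = 0 := by
    have h := IsLocalMin.hasFDerivAt_eq_zero (Filter.Eventually.of_forall hmin)
      (hf xstar).hasFDerivAt
    simpa using h
  have hGL : ∀ y, ‖f' y‖ ≤ L * ‖y - xstar‖ := fun y => by
    simpa [hstar] using hsmooth y xstar
  have hG : Continuous f' :=
    (LipschitzWith.of_dist_le' (K := L) fun y z => by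
      simpa only [dist_eq_norm] using hsmooth y z).continuous
  have hC : 0 ≤ (2 * θ₂ + η₁ * σ ^ 2) / θ₁ := by positivity
  rcases subsingleton_or_nontrivial (EuclideanSpace ℝ (Fin d)) with hsub | hnon
  · intro T _
    have h0 : ∀ v : EuclideanSpace ℝ (Fin d), ‖v‖ = 0 := fun v => by
      rw [Subsingleton.elim v 0, norm_zero]
    simp only [h0]
    simp only [mul_div_assoc]
    simpa using hC
  have hθL : θ₁ ≤ L := dissipativity_const_le hGL hθ₂ hdiss
  have hη₁ρ : η₁ * ((1 + ρ) * L ^ 2) ≤ θ₁ := (le_div_iff₀ (by positivity)).1 hη₁le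
  have hη₁L : η₁ * L ≤ 1 := by
    have h1 : η₁ * L ^ 2 ≤ η₁ * ((1 + ρ) * L ^ 2) := by
      gcongr
      nlinarith [sq_nonneg L]
    have h2 : (η₁ * L) * L ≤ 1 * L := by linarith
    exact le_of_mul_le_mul_right h2 hL
  have ha1 : θ₁ * η₁ ≤ 1 := by nlinarith
  have hxm : ∀ k, AEStronglyMeasurable (fun ω => x k ω - xstar) μ := fun k =>
    (((hmeas k).mono (hℱ k)).sub stronglyMeasurable_const).aestronglyMeasurable
  have main : ∀ T : ℕ, MemLp (fun ω => x (T + 1) ω - xstar) 2 μ →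
      ∫ ω, ‖x (T + 1) ω - xstar‖ ^ 2 ∂μ ≤
        ‖x1 - xstar‖ ^ 2 * (((T : ℝ) + 1) ^ (θ₁ * η₁))⁻¹ + (2 * θ₂ + η₁ * σ ^ 2) / θ₁ := by
    intro T
    induction T with
    | zero =>
      intro _
      simpa [hx1] using hC
    | succ n ih =>
      intro hY
      have hη : η (n + 1) = η₁ / ((n : ℝ) + 1) := by
        rw [hηdef (n + 1) (by omega)]; push_cast; rfl
      have hn : (1 : ℝ) ≤ (n : ℝ) + 1 := by linarith [n.cast_nonneg (α := ℝ)]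
      have hηpos : 0 < η (n + 1) := by rw [hη]; positivity
      have hηle : η (n + 1) ≤ η₁ := by rw [hη]; exact div_le_self hη₁pos.le hn
      have hstep : ∀ ω, x (n + 1 + 1) ω = x (n + 1) ω - η (n + 1) • g (n + 1) ω := fun ω =>
        hx (n + 1) ω (by omega)
      have hX2 : MemLp (fun ω => x (n + 1) ω - xstar) 2 μ := by
        rcases Nat.eq_zero_or_pos n with rfl | hpos
        · simp only [zero_add, hx1]
          exact memLp_const _
        · refine memLp_two_of_sgd_step (hℱ (n + 1)) hGL hθ₁ hdiss hηpos.le ?_ (hmeas (n + 1))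
            (hg (n + 1)) (by simpa only [hstep] using hY)
          have hn' : (1 : ℝ) ≤ n := by exact_mod_cast hpos
          rw [hη, div_mul_eq_mul_div, div_lt_one (by linarith)]
          linarith
      have hg2 : MemLp (g (n + 1)) 2 μ := by
        have h := (hX2.sub hY).const_smul (η (n + 1))⁻¹
        refine h.ae_eq (ae_of_all _ fun ω => ?_)
        simp only [Pi.smul_apply, Pi.sub_apply, hstep]
        rw [sub_sub_sub_cancel_right, sub_sub_cancel, inv_smul_smul₀ hηpos.ne']
      have hrec := integral_norm_sub_sq_sgd_step_le (hℱ (n + 1)) hG hGL hdiss hρ hηpos.le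
        (hmeas (n + 1)) hX2 hg2 (hg (n + 1)) (hvar (n + 1))
      simp only [← hstep] at hrec
      have hD : 0 ≤ ∫ ω, ‖x (n + 1) ω - xstar‖ ^ 2 ∂μ := by positivity
      have hih := ih hX2
      have hrate := one_sub_div_mul_inv_rpow_le (mul_pos hθ₁ hη₁pos).le
        (by linarith : (0 : ℝ) < (n : ℝ) + 1)
      have hdiv : θ₁ * η₁ / ((n : ℝ) + 1) = θ₁ * η (n + 1) := by rw [hη, mul_div_assoc]
      rw [hdiv] at hrate
      push_cast
      set D := ∫ ω, ‖x (n + 1) ω - xstar‖ ^ 2 ∂μ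
      set e := η (n + 1)
      set C := (2 * θ₂ + η₁ * σ ^ 2) / θ₁ with hCdef
      have hCmul : θ₁ * C = 2 * θ₂ + η₁ * σ ^ 2 := mul_div_cancel₀ _ hθ₁.ne'
      have he1 : 0 ≤ 1 - θ₁ * e := by nlinarith
      have hquad : e ^ 2 * ((1 + ρ) * L ^ 2) ≤ e * θ₁ := by
        have : e * ((1 + ρ) * L ^ 2) ≤ θ₁ :=
          (mul_le_mul_of_nonneg_right hηle (by positivity)).trans hη₁ρ
        nlinarith
      have hnoise : e ^ 2 * σ ^ 2 ≤ e * (η₁ * σ ^ 2) := by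
        nlinarith [mul_le_mul_of_nonneg_right hηle (mul_nonneg hηpos.le (sq_nonneg σ))]
      have h1 := mul_le_mul_of_nonneg_right hquad hD
      have h2 := mul_le_mul_of_nonneg_left hih he1
      have h3 := mul_le_mul_of_nonneg_left hrate (sq_nonneg ‖x1 - xstar‖)
      have h4 : e * (θ₁ * C) = e * (2 * θ₂ + η₁ * σ ^ 2) := by rw [hCmul]
      linarith
  intro T _
  rw [div_eq_mul_inv (‖x1 - xstar‖ ^ 2), mul_div_assoc]
  by_cases hT : MemLp (fun ω => x (T + 1) ω - xstar) 2 μ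
  · linarith [main T hT]
  · rw [integral_undef fun h => hT ((memLp_two_iff_integrable_sq_norm (hxm _)).2 h)]
    positivity
end
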